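/- Let F : ℝ^d → ℝ be L-smooth, bounded below by F*, and with ‖∇F(x)‖ ≤ G for all x. Let α > 0 and τ_cut ≥ 1/α, let T ≥ 1, let (τ_t)_{t<T} be delays with 0 ≤ τ_t ≤ min(t, τ_cut), set σ_t = γ(τ_t)·e^{−ατ_t} with γ the cosine gate, and run the noiseless gated delayed-gradient iteration θ_{t+1} = θ_t − η·σ_t·∇F(θ_{t−τ_t}) with step size η = c/√T for some c > 0. Then (1/T)·Σ_{t=0}^{T−1} σ_t·‖∇F(θ_t)‖² ≤ (F(θ_0) − F*)/(c√T) + L·c·G²/(e·α·√T) + L·c·G²/(2√T). The bound holds uniformly over all delay sequences (τ_t) with τ_t ≤ τ_cut; in particular the staleness term depends on α but not on max_t τ_t. -/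

import Mathlib

/-- The cosine gate: `γ(τ) = (1 + cos (π τ / τ_cut)) / 2` for `τ ≤ τ_cut`, and `0` past
the cutoff. -/
noncomputable def cosineGate (τcut τ : ℝ) : ℝ :=
  if τ ≤ τcut then (1 + Real.cos (Real.pi * τ / τcut)) / 2 else 0

open scoped InnerProductSpace in
/-- The descent lemma: the quadratic upper bound for a function with Lipschitz gradient. -/
theorem le_add_inner_gradient_add_sq {E : Type*} [NormedAddCommGroup E] [InnerProductSpace ℝ E]
    [CompleteSpace E] {F : E → ℝ} {L : ℝ} (hF : Differentiable ℝ F)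
    (hL : ∀ x y, ‖gradient F x - gradient F y‖ ≤ L * ‖x - y‖) (x v : E) :
    F (x + v) ≤ F x + ⟪gradient F x, v⟫_ℝ + L / 2 * ‖v‖ ^ 2 := by
  set h : ℝ → ℝ := fun s => F (x + s • v) - s * ⟪gradient F x, v⟫_ℝ - s ^ 2 * (L / 2 * ‖v‖ ^ 2)
    with h_def
  have hderiv : ∀ s, HasDerivAt h
      (⟪gradient F (x + s • v) - gradient F x, v⟫_ℝ - s * (L * ‖v‖ ^ 2)) s := by
    intro s
    have hline : HasDerivAt (fun s : ℝ => x + s • v) v s := by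
      simpa using ((hasDerivAt_id s).smul_const v).const_add x
    have hcomp := (hF (x + s • v)).hasGradientAt.hasFDerivAt.comp_hasDerivAt s hline
    rw [InnerProductSpace.toDual_apply_apply] at hcomp
    refine ((hcomp.sub ((hasDerivAt_id s).mul_const ⟪gradient F x, v⟫_ℝ)).sub
      ((hasDerivAt_pow 2 s).mul_const (L / 2 * ‖v‖ ^ 2))).congr_deriv ?_
    rw [inner_sub_left]
    push_cast
    ring
  have hanti : AntitoneOn h (Set.Icc 0 1) := by
    refine antitoneOn_of_deriv_nonpos (convex_Icc 0 1)
      (fun s _ => (hderiv s).continuousAt.continuousWithinAt)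
      (fun s _ => (hderiv s).differentiableAt.differentiableWithinAt) fun s hs => ?_
    rw [interior_Icc] at hs
    rw [(hderiv s).deriv, sub_nonpos]
    calc ⟪gradient F (x + s • v) - gradient F x, v⟫_ℝ
        ≤ ‖gradient F (x + s • v) - gradient F x‖ * ‖v‖ := real_inner_le_norm _ _
      _ ≤ L * ‖x + s • v - x‖ * ‖v‖ := by gcongr; exact hL _ _
      _ = s * (L * ‖v‖ ^ 2) := by
        rw [add_sub_cancel_left, norm_smul, Real.norm_of_nonneg hs.1.le]
        ring
  have hle : h 1 ≤ h 0 := hanti (by simp) (by simp) zero_le_one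
  simp only [h_def, one_smul, zero_smul, add_zero] at hle
  linarith

theorem cosineGate_nonneg (τcut τ : ℝ) : 0 ≤ cosineGate τcut τ := by
  unfold cosineGate
  split_ifs
  · linarith [Real.neg_one_le_cos (Real.pi * τ / τcut)]
  · rfl

theorem cosineGate_le_one (τcut τ : ℝ) : cosineGate τcut τ ≤ 1 := by
  unfold cosineGate
  split_ifs
  · linarith [Real.cos_le_one (Real.pi * τ / τcut)]
  · exact zero_le_one

theorem mul_exp_neg_mul_le {α : ℝ} (hα : 0 < α) (τ : ℝ) :
    τ * Real.exp (-α * τ) ≤ 1 / (Real.exp 1 * α) := by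
  have h : α * τ ≤ Real.exp (α * τ - 1) := by linarith [Real.add_one_le_exp (α * τ - 1)]
  have hexp : Real.exp (α * τ - 1) * Real.exp (-α * τ) * Real.exp 1 = 1 := by
    rw [← Real.exp_add, ← Real.exp_add, ← Real.exp_zero]
    ring_nf
  rw [le_div_iff₀ (by positivity)]
  calc τ * Real.exp (-α * τ) * (Real.exp 1 * α)
      = α * τ * Real.exp (-α * τ) * Real.exp 1 := by ring
    _ ≤ Real.exp (α * τ - 1) * Real.exp (-α * τ) * Real.exp 1 := by gcongr
    _ = 1 := hexp

theorem norm_sub_le_nat_mul_of_norm_succ_sub_le {E : Type*} [SeminormedAddCommGroup E]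
    {θ : ℕ → E} {B : ℝ} {T : ℕ} (h : ∀ t < T, ‖θ (t + 1) - θ t‖ ≤ B) {t k : ℕ} (ht : t ≤ T)
    (hk : k ≤ t) : ‖θ t - θ (t - k)‖ ≤ k * B := by
  have := dist_le_Ico_sum_of_dist_le (f := θ) (d := fun _ => B) (Nat.sub_le t k)
    fun {i} _ hi => by
      rw [dist_comm, dist_eq_norm]
      exact h i (by omega)
  simpa [dist_comm, dist_eq_norm, norm_sub_rev, Nat.sub_sub_self hk] using this

open scoped InnerProductSpace in
/-- One step of gradient descent along a stale gradient, evaluated at `y`, with weight `s`. -/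
theorem mul_norm_gradient_sq_le_of_stale_step {E : Type*} [NormedAddCommGroup E]
    [InnerProductSpace ℝ E] [CompleteSpace E] {F : E → ℝ} {L G : ℝ} (hF : Differentiable ℝ F)
    (hL : ∀ x y, ‖gradient F x - gradient F y‖ ≤ L * ‖x - y‖) (hL0 : 0 ≤ L)
    (hG : ∀ x, ‖gradient F x‖ ≤ G) {η s : ℝ} (hη : 0 ≤ η) (hs0 : 0 ≤ s) (hs1 : s ≤ 1)
    {x y : E} {D : ℝ} (hD : ‖x - y‖ ≤ D) :
    η * (s * ‖gradient F x‖ ^ 2) ≤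
      F x - F (x - (η * s) • gradient F y) + η * s * (L * D * G) + L / 2 * (η * G) ^ 2 := by
  have hG0 : 0 ≤ G := (norm_nonneg _).trans (hG x)
  have hdesc := le_add_inner_gradient_add_sq hF hL x (-((η * s) • gradient F y))
  rw [← sub_eq_add_neg, inner_neg_right, real_inner_smul_right, norm_neg] at hdesc
  have hstep : ‖(η * s) • gradient F y‖ ≤ η * G := by
    rw [norm_smul, Real.norm_of_nonneg (by positivity)]
    exact mul_le_mul (mul_le_of_le_one_right hη hs1) (hG y) (norm_nonneg _) hη
  have hsq : L / 2 * ‖(η * s) • gradient F y‖ ^ 2 ≤ L / 2 * (η * G) ^ 2 := by gcongr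
  have hinner : ‖gradient F x‖ ^ 2 - ⟪gradient F x, gradient F y⟫_ℝ ≤ L * D * G := by
    rw [← real_inner_self_eq_norm_sq, ← inner_sub_right, real_inner_comm]
    calc ⟪gradient F x - gradient F y, gradient F x⟫_ℝ
        ≤ ‖gradient F x - gradient F y‖ * ‖gradient F x‖ := real_inner_le_norm _ _
      _ ≤ L * D * G := by
        have hD0 := (norm_nonneg _).trans hD
        gcongr
        · exact (hL x y).trans (by gcongr)
        · exact hG x
  have hmul := mul_le_mul_of_nonneg_left hinner (mul_nonneg hη hs0)
  linarith


/-- **noiseless gated delayed-gradient convergence bound.** Let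
`F : ℝ^d → ℝ` be `L`-smooth, bounded below by `F*`, with `‖∇F x‖ ≤ G` everywhere. Let
`α > 0`, `τ_cut ≥ 1/α`, `T ≥ 1`, and delays `τ t ≤ min (t, τ_cut)` for `t < T`. Set
`σ t = γ (τ t) * exp (-α τ t)` with `γ` the cosine gate and run
`θ (t+1) = θ t - (η * σ t) • ∇F (θ (t - τ t))` with `η = c / √T`, `c > 0`. Then
`(1/T) ∑_{t<T} σ t ‖∇F (θ t)‖² ≤ (F θ₀ - F*)/(c√T) + L c G²/(e α √T) + L c G²/(2√T)`,
uniformly over all such delay sequences (the staleness term depends on `α`, not on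
`max τ t`). -/
theorem stmt_12 (d : ℕ) (hd : 0 < d) (L Fstar G α τcut c : ℝ)
    (hα : 0 < α) (hτcut : 1 / α ≤ τcut) (hc : 0 < c)
    (T : ℕ) (hT : 1 ≤ T)
    (F : EuclideanSpace ℝ (Fin d) → ℝ)
    (hF : Differentiable ℝ F)
    (hL : ∀ x y, ‖gradient F x - gradient F y‖ ≤ L * ‖x - y‖)
    (hFstar : ∀ x, Fstar ≤ F x)
    (hG : ∀ x, ‖gradient F x‖ ≤ G)
    (τ : ℕ → ℕ) (hτ : ∀ t < T, τ t ≤ t ∧ (τ t : ℝ) ≤ τcut)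
    (σ : ℕ → ℝ)
    (hσ : ∀ t, σ t = cosineGate τcut (τ t : ℝ) * Real.exp (-α * (τ t : ℝ)))
    (η : ℝ) (hη : η = c / Real.sqrt T)
    (θ : ℕ → EuclideanSpace ℝ (Fin d))
    (hupd : ∀ t < T, θ (t + 1) = θ t - (η * σ t) • gradient F (θ (t - τ t))) :
    (1 / (T : ℝ)) * ∑ t ∈ Finset.range T, σ t * ‖gradient F (θ t)‖ ^ 2 ≤
      (F (θ 0) - Fstar) / (c * Real.sqrt T)
      + L * c * G ^ 2 / (Real.exp 1 * α * Real.sqrt T)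
      + L * c * G ^ 2 / (2 * Real.sqrt T) := by
  have hL0 : 0 ≤ L := by
    have : Nontrivial (EuclideanSpace ℝ (Fin d)) :=
      have : Nonempty (Fin d) := ⟨⟨0, hd⟩⟩
      inferInstance
    obtain ⟨x, y, hxy⟩ := exists_pair_ne (EuclideanSpace ℝ (Fin d))
    exact nonneg_of_mul_nonneg_left ((norm_nonneg _).trans (hL x y))
      (norm_pos_iff.mpr (sub_ne_zero.mpr hxy))
  have hG0 : 0 ≤ G := (norm_nonneg _).trans (hG 0)
  have hT0 : (0 : ℝ) < T := by exact_mod_cast hT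
  have hη0 : 0 < η := by rw [hη]; positivity
  have hσ0 : ∀ t, 0 ≤ σ t := fun t => by
    rw [hσ]
    exact mul_nonneg (cosineGate_nonneg _ _) (Real.exp_pos _).le
  have hσexp : ∀ t, σ t ≤ Real.exp (-α * (τ t : ℝ)) := fun t => by
    rw [hσ]
    exact mul_le_of_le_one_left (Real.exp_pos _).le (cosineGate_le_one _ _)
  have hσ1 : ∀ t, σ t ≤ 1 := fun t =>
    (hσexp t).trans (Real.exp_le_one_iff.mpr (by
      rw [neg_mul, neg_nonpos]
      positivity))
  have hτσ : ∀ t, τ t * σ t ≤ 1 / (Real.exp 1 * α) := fun t =>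
    (mul_le_mul_of_nonneg_left (hσexp t) (Nat.cast_nonneg _)).trans (mul_exp_neg_mul_le hα _)
  have hmove : ∀ t < T, ‖θ (t + 1) - θ t‖ ≤ η * G := fun t ht => by
    rw [hupd t ht, sub_sub_cancel_left, norm_neg, norm_smul,
      Real.norm_of_nonneg (mul_nonneg hη0.le (hσ0 t))]
    exact mul_le_mul (mul_le_of_le_one_right hη0.le (hσ1 t)) (hG _) (norm_nonneg _) hη0.le
  have hstep : ∀ t ∈ Finset.range T, η * (σ t * ‖gradient F (θ t)‖ ^ 2) ≤
      F (θ t) - F (θ (t + 1)) +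
        η ^ 2 * (L * G ^ 2 * (1 / (Real.exp 1 * α)) + L * G ^ 2 / 2) := fun t ht => by
    rw [Finset.mem_range] at ht
    have h := mul_norm_gradient_sq_le_of_stale_step hF hL hL0 hG hη0.le (hσ0 t) (hσ1 t)
      (norm_sub_le_nat_mul_of_norm_succ_sub_le hmove ht.le (hτ t ht).1)
    rw [← hupd t ht] at h
    have hstale := mul_le_mul_of_nonneg_left (hτσ t) (by positivity : 0 ≤ η ^ 2 * (L * G ^ 2))
    linarith
  have hsum := Finset.sum_le_sum hstep
  rw [← Finset.mul_sum, Finset.sum_add_distrib, Finset.sum_range_sub', Finset.sum_const,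
    Finset.card_range, nsmul_eq_mul] at hsum
  have hbound : η * ∑ t ∈ Finset.range T, σ t * ‖gradient F (θ t)‖ ^ 2 ≤ F (θ 0) - Fstar +
      T * (η ^ 2 * (L * G ^ 2 * (1 / (Real.exp 1 * α)) + L * G ^ 2 / 2)) := by
    linarith [hFstar (θ T)]
  have hsqrt : 0 < Real.sqrt T := Real.sqrt_pos.mpr hT0
  have hsqrt_sq : Real.sqrt T ^ 2 = T := Real.sq_sqrt hT0.le
  calc (1 / (T : ℝ)) * ∑ t ∈ Finset.range T, σ t * ‖gradient F (θ t)‖ ^ 2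
      = (η * ∑ t ∈ Finset.range T, σ t * ‖gradient F (θ t)‖ ^ 2) / (η * T) := by
        field_simp
    _ ≤ (F (θ 0) - Fstar + T * (η ^ 2 *
          (L * G ^ 2 * (1 / (Real.exp 1 * α)) + L * G ^ 2 / 2))) / (η * T) := by gcongr
    _ = _ := by
        rw [hη, ← hsqrt_sq, Real.sqrt_sq hsqrt.le]
        field_simp
        ring
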